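/- Let c > 0 and let f : ℝ → ℝ be twice differentiable on (0, ∞) with f''(t) > 0 for all t > 0, such that the map t ↦ t² f''(t) is nondecreasing on (0, ∞). Define g(z) := z f'(z) − f(z) for z > 0. Then the function h : ℝ → ℝ given by h(y) := g(c·e^y) is strictly increasing and convex on ℝ. -/

import Mathlib

/-- Let `c > 0` and let `f` be twice differentiable on `(0, ∞)` with
`f'' > 0` there and with `t ↦ t² f''(t)` nondecreasing on `(0, ∞)`. With
`g z = z f'(z) - f z`, the function `h y = g (c * exp y)` is strictly increasing and
convex on `ℝ`. -/
theorem stmt14 (c : ℝ) (hc : 0 < c) (f f' f'' : ℝ → ℝ)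
    (hderiv1 : ∀ t : ℝ, 0 < t → HasDerivAt f (f' t) t)
    (hderiv2 : ∀ t : ℝ, 0 < t → HasDerivAt f' (f'' t) t)
    (hpos : ∀ t : ℝ, 0 < t → 0 < f'' t)
    (hmono : ∀ s t : ℝ, 0 < s → s ≤ t → s ^ 2 * f'' s ≤ t ^ 2 * f'' t) :
    StrictMono (fun y : ℝ =>
      c * Real.exp y * f' (c * Real.exp y) - f (c * Real.exp y)) ∧
    ConvexOn ℝ Set.univ (fun y : ℝ =>
      c * Real.exp y * f' (c * Real.exp y) - f (c * Real.exp y)) := by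
  have hp : ∀ y : ℝ, 0 < c * Real.exp y := fun y => mul_pos hc (Real.exp_pos y)
  have hd : ∀ y : ℝ, HasDerivAt (fun y : ℝ =>
      c * Real.exp y * f' (c * Real.exp y) - f (c * Real.exp y))
      ((c * Real.exp y) ^ 2 * f'' (c * Real.exp y)) y := by
    intro y
    have he : HasDerivAt (fun y : ℝ => c * Real.exp y) (c * Real.exp y) y :=
      (Real.hasDerivAt_exp y).const_mul c
    have h1 : HasDerivAt (fun y : ℝ => f (c * Real.exp y))
        (f' (c * Real.exp y) * (c * Real.exp y)) y :=
      (hderiv1 _ (hp y)).comp y he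
    have h2 : HasDerivAt (fun y : ℝ => f' (c * Real.exp y))
        (f'' (c * Real.exp y) * (c * Real.exp y)) y :=
      (hderiv2 _ (hp y)).comp y he
    refine ((he.mul h2).sub h1).congr_deriv ?_
    ring
  have hderiv := fun y => (hd y).deriv
  refine ⟨strictMono_of_deriv_pos fun y => ?_, ?_⟩
  · rw [hderiv]
    exact mul_pos (pow_pos (hp y) 2) (hpos _ (hp y))
  · refine Monotone.convexOn_univ_of_deriv (fun y => (hd y).differentiableAt) fun x y hxy => ?_
    rw [hderiv, hderiv]
    exact hmono _ _ (hp x) (mul_le_mul_of_nonneg_left (Real.exp_le_exp.mpr hxy) hc.le)
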